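/- In Hilbert's 1920 equational system, the formula a = a (for a variable a) is not derivable. -/

import Mathlib

/-- Terms of Hilbert's 1920 equational system: individual variables, the constant 1,
and successor `t+1`. -/
inductive Tm0 where
  | var : ℕ → Tm0
  | one : Tm0
  | succ : Tm0 → Tm0

/-- Formulas of Hilbert's 1920 equational system: equations between terms and
implications between formulas. -/
inductive Fm0 where
  | eq : Tm0 → Tm0 → Fm0
  | imp : Fm0 → Fm0 → Fm0

/-- Derivability in Hilbert's 1920 equational system: all substitution instances
(arbitrary terms replacing the variables) of the four axioms `1 = 1`,
`(a = b) → (a+1 = b+1)`, `(a+1 = b+1) → (a = b)`, and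
`(a = b) → ((a = c) → (b = c))`, closed under modus ponens. -/
inductive Deriv0 : Fm0 → Prop where
  | ax1 : Deriv0 (.eq .one .one)
  | ax2 (a b : Tm0) : Deriv0 ((Fm0.eq a b).imp (.eq a.succ b.succ))
  | ax3 (a b : Tm0) : Deriv0 ((Fm0.eq a.succ b.succ).imp (.eq a b))
  | ax4 (a b c : Tm0) : Deriv0 ((Fm0.eq a b).imp ((Fm0.eq a c).imp (.eq b c)))
  | mp (A B : Fm0) : Deriv0 A → Deriv0 (A.imp B) → Deriv0 B

/-- A term is closed if it contains no variable. -/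
def Tm0.Closed : Tm0 → Prop
  | .var _ => False
  | .one => True
  | .succ t => t.Closed

/-- Truth of a formula when an equation is read as `both sides are the same closed term` and
implication is classical. -/
def Fm0.Holds : Fm0 → Prop
  | .eq s t => s = t ∧ s.Closed
  | .imp A B => A.Holds → B.Holds

/-- Every derivable formula holds in the closed-term interpretation. -/
theorem Deriv0.holds {A : Fm0} (h : Deriv0 A) : A.Holds := by
  induction h with
  | ax1 => exact ⟨rfl, trivial⟩
  | ax2 a b => exact fun ⟨hab, ha⟩ => ⟨congrArg Tm0.succ hab, ha⟩
  | ax3 a b => exact fun ⟨hab, ha⟩ => ⟨Tm0.succ.inj hab, ha⟩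
  | ax4 a b c => exact fun ⟨hab, ha⟩ ⟨hac, _⟩ => ⟨hab.symm.trans hac, hab ▸ ha⟩
  | mp A B _ _ ihA ihAB => exact ihAB ihA

/-- In Hilbert's 1920 equational system, the formula `a = a` (for a variable `a`)
is not derivable. -/
theorem not_deriv_var_eq_self (a : ℕ) : ¬ Deriv0 (Fm0.eq (.var a) (.var a)) :=
  fun h => h.holds.2
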